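/- arXiv:math/0408078 — 8 statements merged into one kernel-verified Lean document; each statement's English description precedes it below -/
import Mathlib

section
/- Let M and M' be two such template matrices (with the same index vector w) which agree in every column except column i+1, for some 1 ≤ i < m. Suppose column i of both M and M' uses the pair (y*, y), column i+1 of M uses the pair (R, r), and column i+1 of M' uses the pair (y*, y). Then det M = det M'. -/
/-- The template matrix: `kstar` starred rows followed by `k` standard rows,
index vector `w`, column assignment `C` of pairs of sequences. The `(i,j)` entry
(0-indexed; 1-indexed column `j+1`) is `(C j).1 (w i - j)` on starred rows
(i.e. `P_{w_i - (j+1) + 1}`) and `(C j).2 (w i + j)` on standard rows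
(i.e. `p_{w_i + (j+1) - 1}`). -/
def TM {A : Type*} [CommRing A] (kstar k : ℕ) (w : Fin (kstar + k) → ℤ)
    (C : Fin (kstar + k) → (ℤ → A) × (ℤ → A)) :
    Matrix (Fin (kstar + k)) (Fin (kstar + k)) A :=
  Matrix.of fun i j =>
    if (i : ℕ) < kstar then (C j).1 (w i - ((j : ℕ) : ℤ)) else (C j).2 (w i + ((j : ℕ) : ℤ))

theorem stmt0 {A : Type*} [CommRing A] (s : Aˣ) (a : A)
    (y ystar l r L R : ℤ → A)
    (hyl : ∀ n : ℤ, y n = (↑s⁻¹ : A) * a * y (n - 1) + l n)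
    (hyr : ∀ n : ℤ, y n = (↑s : A) * a * y (n - 1) + r n)
    (hyL : ∀ n : ℤ, ystar (n - 1) = (↑s⁻¹ : A) * a * ystar n + L (n - 1))
    (hyR : ∀ n : ℤ, ystar (n - 1) = (↑s : A) * a * ystar n + R (n - 1))
    (kstar k : ℕ) (w : Fin (kstar + k) → ℤ)
    (C C' : Fin (kstar + k) → (ℤ → A) × (ℤ → A))
    (i : ℕ) (hi1 : 1 ≤ i) (hi2 : i < kstar + k)
    (hCi : C ⟨i - 1, by omega⟩ = (ystar, y))
    (hC'i : C' ⟨i - 1, by omega⟩ = (ystar, y))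
    (hCi1 : C ⟨i, hi2⟩ = (R, r))
    (hC'i1 : C' ⟨i, hi2⟩ = (ystar, y))
    (hagree : ∀ j : Fin (kstar + k), (j : ℕ) ≠ i → C j = C' j) :
    (TM kstar k w C).det = (TM kstar k w C').det := by
  have h : TM kstar k w C = (TM kstar k w C').updateCol ⟨i, hi2⟩
      (fun p => TM kstar k w C' p ⟨i, hi2⟩
        + (-((s : A) * a)) • TM kstar k w C' p ⟨i - 1, by omega⟩) := by
    ext p j
    rw [Matrix.updateCol_apply]
    split_ifs with hj
    · subst hj
      simp only [TM, Matrix.of_apply, hCi1, hC'i1, hC'i, smul_eq_mul]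
      push_cast [hi1]
      split_ifs
      · have e := hyR (w p - (i - 1))
        rw [show w p - ((i : ℤ) - 1) - 1 = w p - i by ring] at e
        linear_combination -e
      · have e := hyr (w p + i)
        rw [show w p + (i : ℤ) - 1 = w p + (i - 1) by ring] at e
        linear_combination -e
    · simp only [TM, Matrix.of_apply, hagree j fun hji => hj (Fin.ext hji)]
  rw [h]
  refine Matrix.det_updateCol_add_smul_self _ (fun hij => ?_) _
  have := Fin.mk.inj hij
  omega
end

section
/- Let M and M' be two such template matrices (with the same index vector w) which agree in every column except column i+1, for some 1 ≤ i < m. Suppose column i of both M and M' uses the pair (y*, y), column i+1 of M uses the pair (L, l), and column i+1 of M' uses the pair (y*, y). Then det M = det M'. -/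
theorem stmt1 {A : Type*} [CommRing A] (s : Aˣ) (a : A)
    (y ystar l r L R : ℤ → A)
    (hyl : ∀ n : ℤ, y n = (↑s⁻¹ : A) * a * y (n - 1) + l n)
    (hyr : ∀ n : ℤ, y n = (↑s : A) * a * y (n - 1) + r n)
    (hyL : ∀ n : ℤ, ystar (n - 1) = (↑s⁻¹ : A) * a * ystar n + L (n - 1))
    (hyR : ∀ n : ℤ, ystar (n - 1) = (↑s : A) * a * ystar n + R (n - 1))
    (kstar k : ℕ) (w : Fin (kstar + k) → ℤ)
    (C C' : Fin (kstar + k) → (ℤ → A) × (ℤ → A))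
    (i : ℕ) (hi1 : 1 ≤ i) (hi2 : i < kstar + k)
    (hCi : C ⟨i - 1, by omega⟩ = (ystar, y))
    (hC'i : C' ⟨i - 1, by omega⟩ = (ystar, y))
    (hCi1 : C ⟨i, hi2⟩ = (L, l))
    (hC'i1 : C' ⟨i, hi2⟩ = (ystar, y))
    (hagree : ∀ j : Fin (kstar + k), (j : ℕ) ≠ i → C j = C' j) :
    (TM kstar k w C).det = (TM kstar k w C').det := by
  have hne : (⟨i, hi2⟩ : Fin (kstar + k)) ≠ ⟨i - 1, by omega⟩ := by
    simp only [ne_eq, Fin.mk.injEq]; omega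
  rw [← Matrix.det_updateCol_add_smul_self (TM kstar k w C) hne ((↑s⁻¹ : A) * a)]
  congr 1
  ext p j
  have hcast : ((i - 1 : ℕ) : ℤ) = (i : ℤ) - 1 := by omega
  by_cases hj : j = ⟨i, hi2⟩
  · subst hj
    simp only [Matrix.updateCol_self, TM, Matrix.of_apply, hCi, hCi1, hC'i1, smul_eq_mul, hcast]
    split_ifs
    · have h := hyL (w p - i + 1)
      rw [add_sub_cancel_right] at h
      rw [h, sub_sub_eq_add_sub, sub_add_eq_add_sub, add_comm]
    · rw [hyl (w p + i), add_sub_assoc, add_comm]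
  · rw [Matrix.updateCol_ne hj]
    simp only [TM, Matrix.of_apply, hagree j fun h => hj (Fin.ext h)]
end

section
/- Fix 1 ≤ j ≤ m and an arbitrary assignment of column pairs to columns 1,…,j−1. Let M_R be the template matrix whose column j uses (y*, y) and whose columns j+1,…,m all use (R, r); let M_Y be the template matrix whose columns j,…,m all use (y*, y); and let M_L be the template matrix whose column j uses (y*, y) and whose columns j+1,…,m all use (L, l), where M_R, M_Y, M_L all have the same columns 1,…,j−1 and the same index vector w. Then det M_R = det M_Y = det M_L. -/
/-- Subtracting a fixed multiple of the preceding column from each column with index at least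
`j ≥ 1` does not change the determinant. -/
theorem det_eq_of_forall_le_col_eq_add_mul_pred {A : Type*} [CommRing A] {n : ℕ}
    {M B : Matrix (Fin n) (Fin n) A} (c : A) {j : ℕ} (hj : 1 ≤ j)
    (hlt : ∀ i q : Fin n, (q : ℕ) < j → M i q = B i q)
    (hle : ∀ i p q : Fin n, j ≤ (q : ℕ) → (q : ℕ) = p + 1 → M i q = B i q + c * M i p) :
    M.det = B.det := by
  cases n with
  | zero => simp
  | succ n =>
    refine Matrix.det_eq_of_forall_col_eq_smul_add_pred
      (fun p => if j ≤ (p : ℕ) + 1 then c else 0) (fun i => hlt i 0 hj) fun i p => ?_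
    split_ifs with h
    · exact hle i p.castSucc p.succ (by simpa using h) (by simp)
    · rw [zero_mul, add_zero]
      exact hlt i p.succ (by simpa using h)

/-- If `ystar` and `y` satisfy first-order recurrences with multiplier `c` and inhomogeneous
terms `P` and `p`, then replacing `(ystar, y)` by `(P, p)` in all columns after a column equal to
`(ystar, y)` does not change the determinant of the template matrix. -/
theorem det_TM_eq_of_recurrence {A : Type*} [CommRing A] (c : A) {y ystar p P : ℤ → A}
    (hy : ∀ n : ℤ, y n = c * y (n - 1) + p n)
    (hystar : ∀ n : ℤ, ystar (n - 1) = c * ystar n + P (n - 1))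
    {kstar k : ℕ} (w : Fin (kstar + k) → ℤ) {j : ℕ} (hj : 1 ≤ j)
    {C D : Fin (kstar + k) → (ℤ → A) × (ℤ → A)}
    (hlt : ∀ q : Fin (kstar + k), (q : ℕ) < j → C q = D q)
    (hC : ∀ q : Fin (kstar + k), j - 1 ≤ (q : ℕ) → C q = (ystar, y))
    (hD : ∀ q : Fin (kstar + k), j ≤ (q : ℕ) → D q = (P, p)) :
    (TM kstar k w C).det = (TM kstar k w D).det := by
  refine det_eq_of_forall_le_col_eq_add_mul_pred c hj (fun i q hq => ?_)
    fun i t q hq htq => ?_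
  · simp only [TM, Matrix.of_apply, hlt q hq]
  · simp only [TM, Matrix.of_apply, hC q (by omega), hC t (by omega), hD q hq, htq]
    push_cast
    split_ifs
    · rw [← sub_sub, hystar, add_comm]
    · rw [← add_assoc, hy, add_sub_cancel_right, add_comm]

theorem stmt2 {A : Type*} [CommRing A] (s : Aˣ) (a : A)
    (y ystar l r L R : ℤ → A)
    (hyl : ∀ n : ℤ, y n = (↑s⁻¹ : A) * a * y (n - 1) + l n)
    (hyr : ∀ n : ℤ, y n = (↑s : A) * a * y (n - 1) + r n)
    (hyL : ∀ n : ℤ, ystar (n - 1) = (↑s⁻¹ : A) * a * ystar n + L (n - 1))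
    (hyR : ∀ n : ℤ, ystar (n - 1) = (↑s : A) * a * ystar n + R (n - 1))
    (kstar k : ℕ) (w : Fin (kstar + k) → ℤ)
    (j : ℕ) (hj1 : 1 ≤ j) (hj2 : j ≤ kstar + k)
    (CR CY CL : Fin (kstar + k) → (ℤ → A) × (ℤ → A))
    (hpre : ∀ j' : Fin (kstar + k), (j' : ℕ) < j - 1 → CR j' = CY j' ∧ CL j' = CY j')
    (hRj : CR ⟨j - 1, by omega⟩ = (ystar, y))
    (hYj : CY ⟨j - 1, by omega⟩ = (ystar, y))
    (hLj : CL ⟨j - 1, by omega⟩ = (ystar, y))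
    (hRpost : ∀ j' : Fin (kstar + k), j ≤ (j' : ℕ) → CR j' = (R, r))
    (hYpost : ∀ j' : Fin (kstar + k), j ≤ (j' : ℕ) → CY j' = (ystar, y))
    (hLpost : ∀ j' : Fin (kstar + k), j ≤ (j' : ℕ) → CL j' = (L, l)) :
    (TM kstar k w CR).det = (TM kstar k w CY).det ∧
      (TM kstar k w CY).det = (TM kstar k w CL).det := by
  have hY : ∀ q : Fin (kstar + k), j - 1 ≤ (q : ℕ) → CY q = (ystar, y) := by
    intro q hq
    rcases hq.eq_or_lt with h | h
    · rw [← hYj]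
      exact congrArg CY (Fin.ext h.symm)
    · exact hYpost q (by omega)
  have agree : ∀ C : Fin (kstar + k) → (ℤ → A) × (ℤ → A),
      (∀ q : Fin (kstar + k), (q : ℕ) < j - 1 → C q = CY q) →
      C ⟨j - 1, by omega⟩ = (ystar, y) →
      ∀ q : Fin (kstar + k), (q : ℕ) < j → CY q = C q := by
    intro C hC hCj q hq
    rcases Nat.lt_or_ge (q : ℕ) (j - 1) with h | h
    · exact (hC q h).symm
    · rw [hY q h, ← hCj]
      exact congrArg C (Fin.ext (by simp only; omega))
  exact ⟨(det_TM_eq_of_recurrence _ hyr hyR w hj1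
      (agree CR (fun q hq => (hpre q hq).1) hRj) hY hRpost).symm,
    det_TM_eq_of_recurrence _ hyl hyL w hj1
      (agree CL (fun q hq => (hpre q hq).2) hLj) hY hLpost⟩
end

section
/- For each 1 ≤ j ≤ m, let Y_j be the template matrix (with index vector w) whose column j uses the pair (y*, y) and whose other columns all use the pair (L, l). Then (s − s^{-1})·det Y_j = s·Δ_j − s^{-1}·Δ_{j−1}. -/
/-- Adding to each column a multiple of the already modified preceding column preserves the
determinant. -/
theorem det_eq_of_forall_col_eq_mul_add_pred {A : Type*} [CommRing A] {m : ℕ}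
    {M N : Matrix (Fin m) (Fin m) A} (c : ℕ → A)
    (h_zero : ∀ i j : Fin m, (j : ℕ) = 0 → M i j = N i j)
    (h_succ : ∀ i j j' : Fin m, (j' : ℕ) = (j : ℕ) + 1 → M i j' = N i j' + c j * M i j) :
    M.det = N.det := by
  cases m with
  | zero => simp
  | succ n =>
    exact Matrix.det_eq_of_forall_col_eq_smul_add_pred (fun j => c j)
      (fun i => h_zero i 0 rfl) (fun i j => h_succ i j.castSucc j.succ (by simp))

/-- Columns after the column `p` carrying `(ystar, y)` may be replaced by `(ystar, y)` when they
satisfy first-order recurrences with a common coefficient. -/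
theorem det_TM_tail_eq {A : Type*} [CommRing A] (c : A) (y ystar x X : ℤ → A)
    (hx : ∀ n : ℤ, y n = c * y (n - 1) + x n)
    (hX : ∀ n : ℤ, ystar (n - 1) = c * ystar n + X (n - 1))
    (H : (ℤ → A) × (ℤ → A)) (kstar k : ℕ) (w : Fin (kstar + k) → ℤ) (p : ℕ) :
    (TM kstar k w (fun j => if (j : ℕ) < p then H else (ystar, y))).det =
      (TM kstar k w (fun j => if (j : ℕ) < p then H else
        if (j : ℕ) = p then (ystar, y) else (X, x))).det := by
  refine det_eq_of_forall_col_eq_mul_add_pred (fun j => if j < p then 0 else c) ?_ ?_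
  · intro i j hj
    simp only [TM, Matrix.of_apply, hj]
    by_cases hp : 0 < p
    · simp [hp]
    · simp [show p = 0 by omega]
  · intro i j j' hj
    simp only [TM, Matrix.of_apply, hj]
    rcases lt_trichotomy ((j : ℕ) + 1) p with h | h | h
    · simp [h, show (j : ℕ) < p by omega]
    · simp [h, show (j : ℕ) < p by omega]
    · have h1 : ¬ (j : ℕ) < p := by omega
      have h2 : ¬ (j : ℕ) + 1 < p := by omega
      have h3 : (j : ℕ) + 1 ≠ p := by omega
      simp only [h1, h2, h3, if_false]
      push_cast
      split_ifs
      · have := hX (w i - (j : ℕ))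
        rw [sub_sub] at this
        rw [this, add_comm]
      · have := hx (w i + ((j : ℕ) + 1))
        rw [show w i + (((j : ℕ) : ℤ) + 1) - 1 = w i + (j : ℕ) by ring] at this
        rw [this, add_comm]

/-- The determinant of a template matrix is linear in the pair assigned to a single column. -/
theorem det_TM_linear {A : Type*} [CommRing A] (kstar k : ℕ) (w : Fin (kstar + k) → ℤ)
    (p : Fin (kstar + k)) (C₀ C₁ C₂ : Fin (kstar + k) → (ℤ → A) × (ℤ → A)) (d b c : A)
    (h₁ : ∀ j, j ≠ p → C₁ j = C₀ j) (h₂ : ∀ j, j ≠ p → C₂ j = C₀ j)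
    (hp : d • C₀ p = b • C₁ p - c • C₂ p) :
    d * (TM kstar k w C₀).det = b * (TM kstar k w C₁).det - c * (TM kstar k w C₂).det := by
  have key (C : Fin (kstar + k) → (ℤ → A) × (ℤ → A)) (hC : ∀ j, j ≠ p → C j = C₀ j) :
      TM kstar k w C = (TM kstar k w C₀).updateCol p (fun i => TM kstar k w C i p) := by
    ext i j
    by_cases hj : j = p
    · subst hj; simp
    · simp [hj, TM, hC j hj]
  have hcol : b • (fun i => TM kstar k w C₁ i p) =
      d • (fun i => TM kstar k w C₀ i p) + c • (fun i => TM kstar k w C₂ i p) := by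
    funext i
    have e1 := fun n => congrFun (congrArg Prod.fst hp) n
    have e2 := fun n => congrFun (congrArg Prod.snd hp) n
    simp only [Prod.smul_fst, Prod.smul_snd, Prod.fst_sub, Prod.snd_sub, Pi.smul_apply,
      Pi.sub_apply, smul_eq_mul] at e1 e2
    simp only [TM, Matrix.of_apply, Pi.smul_apply, Pi.add_apply, smul_eq_mul]
    split_ifs
    · rw [e1]; ring
    · rw [e2]; ring
  rw [congrArg Matrix.det (key C₀ fun _ _ => rfl), key C₁ h₁, key C₂ h₂, eq_sub_iff_add_eq,
    ← Matrix.det_updateCol_smul, ← Matrix.det_updateCol_smul, ← Matrix.det_updateCol_smul,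
    ← Matrix.det_updateCol_add, hcol]

theorem stmt4 {A : Type*} [CommRing A] (s : Aˣ) (a : A)
    (y ystar l r L R : ℤ → A)
    (hyl : ∀ n : ℤ, y n = (↑s⁻¹ : A) * a * y (n - 1) + l n)
    (hyr : ∀ n : ℤ, y n = (↑s : A) * a * y (n - 1) + r n)
    (hyL : ∀ n : ℤ, ystar (n - 1) = (↑s⁻¹ : A) * a * ystar n + L (n - 1))
    (hyR : ∀ n : ℤ, ystar (n - 1) = (↑s : A) * a * ystar n + R (n - 1))
    (kstar k : ℕ) (w : Fin (kstar + k) → ℤ)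
    (j : ℕ) (hj1 : 1 ≤ j) (hj2 : j ≤ kstar + k) :
    ((↑s : A) - (↑s⁻¹ : A)) *
        (TM kstar k w (fun j' => if (j' : ℕ) = j - 1 then (ystar, y) else (L, l))).det =
      (↑s : A) * (TM kstar k w (fun j' => if (j' : ℕ) < j then (L, l) else (R, r))).det -
        (↑s⁻¹ : A) * (TM kstar k w (fun j' => if (j' : ℕ) < j - 1 then (L, l) else (R, r))).det := by
  obtain ⟨p, rfl⟩ : ∃ p, j = p + 1 := ⟨j - 1, by omega⟩
  simp only [Nat.add_sub_cancel]
  have hs : (↑s : A) * (↑s⁻¹ : A) = 1 := s.mul_inv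
  have hy (n : ℤ) : ((↑s : A) - (↑s⁻¹ : A)) * y n = (↑s : A) * l n - (↑s⁻¹ : A) * r n := by
    linear_combination (↑s : A) * hyl n - (↑s⁻¹ : A) * hyr n
  have hystar (n : ℤ) :
      ((↑s : A) - (↑s⁻¹ : A)) * ystar n = (↑s : A) * L n - (↑s⁻¹ : A) * R n := by
    have h1 := hyL (n + 1)
    have h2 := hyR (n + 1)
    rw [add_sub_cancel_right] at h1 h2
    linear_combination (↑s : A) * h1 - (↑s⁻¹ : A) * h2
  have hY : (fun j' : Fin (kstar + k) => if (j' : ℕ) = p then (ystar, y) else (L, l)) =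
      fun j' : Fin (kstar + k) => if (j' : ℕ) < p then (L, l) else
        if (j' : ℕ) = p then (ystar, y) else (L, l) := by
    funext j'
    split_ifs <;> first | rfl | omega
  rw [hY, ← det_TM_tail_eq _ y ystar l L hyl hyL, det_TM_tail_eq _ y ystar r R hyr hyR]
  refine det_TM_linear kstar k w ⟨p, by omega⟩ _ _ _ _ _ _ ?_ ?_ ?_
  · intro j' hj'
    have : (j' : ℕ) ≠ p := fun h => hj' (Fin.ext h)
    split_ifs <;> first | rfl | omega
  · intro j' hj'
    have : (j' : ℕ) ≠ p := fun h => hj' (Fin.ext h)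
    simp [this]
  · ext n
    · simpa using hystar n
    · simpa using hy n
end

section
/- For each 1 ≤ j ≤ m, let N_j be the template matrix (with index vector w) whose column j uses the pair (R, r) and whose other columns all use the pair (L, l). Then s·Δ_j − s^{-1}·Δ_{j−1} = s·Δ_m − s^{-1}·det N_j. -/
/-- Adding to each column after the `q`-th one a fixed multiple of the preceding column
does not change the determinant. -/
theorem Matrix.det_eq_of_forall_col_gt_eq_add_pred {A : Type*} [CommRing A] {n : ℕ}
    (M N : Matrix (Fin n) (Fin n) A) (q : Fin n) (c : A)
    (hle : ∀ i j, j ≤ q → M i j = N i j)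
    (hgt : ∀ i (j j' : Fin n), q < j → (j' : ℕ) + 1 = j → M i j = N i j + c * M i j') :
    M.det = N.det := by
  cases n with
  | zero => exact q.elim0
  | succ n =>
    refine Matrix.det_eq_of_forall_col_eq_smul_add_pred
      (fun j => if q < j.succ then c else 0) (fun i => hle i 0 (Fin.zero_le q)) fun i j => ?_
    by_cases h : q < j.succ
    · simpa [h] using hgt i j.succ j.castSucc h (by simp)
    · simpa [h] using hle i j.succ (not_lt.mp h)

/-- A linear combination of the determinants of two matrices that agree outside one column. -/
theorem Matrix.mul_det_sub_mul_det_of_col {A ι : Type*} [CommRing A] [Fintype ι] [DecidableEq ι]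
    (P Q : Matrix ι ι A) (q : ι) (b c d : A) (v : ι → A)
    (hne : ∀ i j, j ≠ q → P i j = Q i j)
    (hq : ∀ i, b * P i q - c * Q i q = d * v i) :
    b * P.det - c * Q.det = d * (P.updateCol q v).det := by
  have hQ : Q = P.updateCol q (fun i => Q i q) := by
    ext i j
    by_cases h : j = q
    · subst h; simp
    · simp [h, hne i j h]
  have hP : P = P.updateCol q (fun i => P i q) := by
    ext i j
    by_cases h : j = q
    · subst h; simp
    · simp [h]
  have hv : b • (fun i => P i q) = d • v + c • fun i => Q i q := by
    ext i
    simpa using sub_eq_iff_eq_add.mp (hq i)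
  have key := congrArg (fun x => (P.updateCol q x).det) hv
  simp only [Matrix.det_updateCol_add, Matrix.det_updateCol_smul] at key
  rw [← hP, ← hQ] at key
  exact sub_eq_iff_eq_add.mpr key


theorem stmt5 {A : Type*} [CommRing A] (s : Aˣ) (a : A)
    (y ystar l r L R : ℤ → A)
    (hyl : ∀ n : ℤ, y n = (↑s⁻¹ : A) * a * y (n - 1) + l n)
    (hyr : ∀ n : ℤ, y n = (↑s : A) * a * y (n - 1) + r n)
    (hyL : ∀ n : ℤ, ystar (n - 1) = (↑s⁻¹ : A) * a * ystar n + L (n - 1))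
    (hyR : ∀ n : ℤ, ystar (n - 1) = (↑s : A) * a * ystar n + R (n - 1))
    (kstar k : ℕ) (w : Fin (kstar + k) → ℤ)
    (j : ℕ) (hj1 : 1 ≤ j) (hj2 : j ≤ kstar + k) :
    (↑s : A) * (TM kstar k w (fun j' => if (j' : ℕ) < j then (L, l) else (R, r))).det -
        (↑s⁻¹ : A) * (TM kstar k w (fun j' => if (j' : ℕ) < j - 1 then (L, l) else (R, r))).det =
      (↑s : A) * (TM kstar k w (fun _ => (L, l))).det -
        (↑s⁻¹ : A) * (TM kstar k w (fun j' => if (j' : ℕ) = j - 1 then (R, r) else (L, l))).det := by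
  set q : Fin (kstar + k) := ⟨j - 1, by omega⟩ with hq
  have hlt (j' : Fin (kstar + k)) : (j' : ℕ) < j ↔ j' ≤ q := by
    rw [Fin.le_def]; simp only [hq]; omega
  have hlt' (j' : Fin (kstar + k)) : (j' : ℕ) < j - 1 ↔ j' < q := by
    rw [Fin.lt_def]
  have heq (j' : Fin (kstar + k)) : (j' : ℕ) = j - 1 ↔ j' = q := by
    rw [Fin.ext_iff]
  simp only [hlt, hlt', heq]
  have hs : (↑s : A) * (↑s⁻¹ : A) = 1 := s.mul_inv
  have hcol (i : Fin (kstar + k)) : (↑s : A) * TM kstar k w (fun _ => (L, l)) i q -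
      (↑s⁻¹ : A) * TM kstar k w (fun _ => (R, r)) i q =
      ((↑s : A) - (↑s⁻¹ : A)) * TM kstar k w (fun _ => (ystar, y)) i q := by
    simp only [TM, Matrix.of_apply]
    split_ifs
    · have h₁ := hyL (w i - ((q : ℕ) : ℤ) + 1)
      have h₂ := hyR (w i - ((q : ℕ) : ℤ) + 1)
      rw [add_sub_cancel_right] at h₁ h₂
      linear_combination (-(↑s : A)) * h₁ + (↑s⁻¹ : A) * h₂
    · linear_combination (-(↑s : A)) * hyl (w i + ((q : ℕ) : ℤ)) +
        (↑s⁻¹ : A) * hyr (w i + ((q : ℕ) : ℤ))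
  have hrec (c : A) (U u : ℤ → A) (hu : ∀ n : ℤ, y n = c * a * y (n - 1) + u n)
      (hU : ∀ n : ℤ, ystar (n - 1) = c * a * ystar n + U (n - 1))
      (i j₁ j₂ : Fin (kstar + k)) (hj : (j₂ : ℕ) + 1 = j₁) :
      TM kstar k w (fun _ => (ystar, y)) i j₁ = TM kstar k w (fun _ => (U, u)) i j₁ +
        c * a * TM kstar k w (fun _ => (ystar, y)) i j₂ := by
    simp only [TM, Matrix.of_apply, ← hj]
    push_cast
    split_ifs
    · have h := hU (w i - ((j₂ : ℕ) : ℤ))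
      rw [← sub_sub, h, add_comm]
    · have h := hu (w i + (((j₂ : ℕ) : ℤ) + 1))
      rw [h, add_comm, ← add_assoc, add_sub_cancel_right]
  have hcongr (C C' : Fin (kstar + k) → (ℤ → A) × (ℤ → A)) (i j' : Fin (kstar + k))
      (h : C j' = C' j') : TM kstar k w C i j' = TM kstar k w C' i j' := by
    simp only [TM, Matrix.of_apply, h]
  have hdet (c : A) (U u : ℤ → A) (hu : ∀ n : ℤ, y n = c * a * y (n - 1) + u n)
      (hU : ∀ n : ℤ, ystar (n - 1) = c * a * ystar n + U (n - 1))
      (C : Fin (kstar + k) → (ℤ → A) × (ℤ → A)) (hC : ∀ j', j' < q → C j' = (L, l))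
      (hC' : ∀ j', q < j' → C j' = (U, u)) :
      (TM kstar k w fun j' => if j' < q then (L, l) else (ystar, y)).det =
        ((TM kstar k w C).updateCol q fun i => TM kstar k w (fun _ => (ystar, y)) i q).det := by
    refine Matrix.det_eq_of_forall_col_gt_eq_add_pred _ _ q (c * a) (fun i j' h => ?_)
      fun i j₁ j₂ h hj => ?_
    · rcases h.lt_or_eq with h | rfl
      · rw [Matrix.updateCol_ne h.ne]
        exact hcongr _ _ _ _ (by simp [h, hC])
      · rw [Matrix.updateCol_self]
        exact hcongr _ _ _ _ (by simp)
    · have h₂ : ¬ j₂ < q := by rw [Fin.lt_def] at h ⊢; omega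
      rw [Matrix.updateCol_ne h.ne', hcongr C (fun _ => (U, u)) i j₁ (hC' j₁ h),
        hcongr _ (fun _ => (ystar, y)) i j₁ (by simp [h.not_gt]),
        hcongr _ (fun _ => (ystar, y)) i j₂ (by simp [h₂])]
      exact hrec c U u hu hU i j₁ j₂ hj
  rw [Matrix.mul_det_sub_mul_det_of_col _ _ q _ _ _
      (fun i => TM kstar k w (fun _ => (ystar, y)) i q)
      (fun i j' h => hcongr _ _ i j' (by simp [h.le_iff_lt]))
      (fun i => by
        rw [← hcol i, hcongr _ (fun _ => (L, l)) i q (by simp),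
          hcongr (fun j' => if j' < q then (L, l) else (R, r)) (fun _ => (R, r)) i q (by simp)]),
    Matrix.mul_det_sub_mul_det_of_col (TM kstar k w fun _ => (L, l)) _ q _ _ _
      (fun i => TM kstar k w (fun _ => (ystar, y)) i q)
      (fun i j' h => hcongr _ _ i j' (by simp [h]))
      (fun i => by
        rw [← hcol i,
          hcongr (fun j' => if j' = q then (R, r) else (L, l)) (fun _ => (R, r)) i q (by simp)]),
    ← hdet _ R r hyr hyR _ (fun j' h => by simp [h.le]) (fun j' h => by simp [h.not_ge]),
    ← hdet _ L l hyl hyL _ (fun _ _ => rfl) (fun _ _ => rfl)]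
end

section
/- For each 1 ≤ j ≤ m, let N_j be the template matrix (with index vector w) whose column j uses the pair (R, r) and whose other columns all use the pair (L, l). Then (Σ_{j=1}^{m−1} s^{2j})·Δ_m + Δ_0 = Σ_{j=1}^{m} s^{2j−2}·det N_j. -/
/-- Expansion of the determinant of a matrix whose `j`-th column is a combination of two consecutive
columns of an `n × (n + 1)` matrix, in terms of the maximal minors of the latter. -/
theorem Matrix.det_sub_mul_pred {R : Type*} [CommRing R] {n : ℕ}
    (V : Matrix (Fin n) (Fin (n + 1)) R) (c : ℕ → R) :
    (Matrix.of fun i j : Fin n => V i j.succ - c j * V i j.castSucc).det =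
      ∑ q : Fin (n + 1), (-1) ^ (q : ℕ) * (∏ j ∈ Finset.range q, c j) *
        (V.submatrix id q.succAbove).det := by
  obtain ⟨M, hM₀, hM⟩ : ∃ M : Matrix (Fin (n + 1)) (Fin (n + 1)) R,
      (∀ q, M 0 q = ∏ j ∈ Finset.range q, c j) ∧ ∀ i q, M (Fin.succ i) q = V i q :=
    ⟨fun i q => Fin.cases (motive := fun _ => R) (∏ j ∈ Finset.range q, c j) (fun i => V i q) i,
      fun _ => rfl, fun _ _ => rfl⟩
  obtain ⟨B, hB, hB₀, hB₀'⟩ : ∃ B : Matrix (Fin (n + 1)) (Fin (n + 1)) R,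
      (∀ i j, B i (Fin.succ j) = M i j.succ - c j * M i j.castSucc) ∧ B 0 0 = 1 ∧
        ∀ i, B i 0 = M i 0 :=
    ⟨fun i q => Fin.cases (motive := fun _ => R) (M i 0)
      (fun j => M i j.succ - c j * M i j.castSucc) q,
      fun _ _ => rfl, by simp [hM₀], fun _ => rfl⟩
  have hB₁ : ∀ j, B 0 (Fin.succ j) = 0 := fun j => by
    simp [hB, hM₀, Finset.prod_range_succ, mul_comm]
  have hsub : B.submatrix Fin.succ Fin.succ =
      Matrix.of fun i j : Fin n => V i j.succ - c j * V i j.castSucc := by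
    ext i j
    simp [hB, hM]
  have hMsub : ∀ q : Fin (n + 1), M.submatrix Fin.succ q.succAbove = V.submatrix id q.succAbove :=
    fun q => by ext i j; simp [hM]
  have key := Matrix.det_eq_of_forall_col_eq_smul_add_pred (A := M) (B := B)
    (fun j : Fin n => c j) (fun i => (hB₀' i).symm) (fun i j => by rw [hB]; ring)
  rw [Matrix.det_succ_row_zero M, Matrix.det_succ_row_zero B, Fin.sum_univ_succ (n := n)
    (f := fun q => (-1) ^ (q : ℕ) * B 0 q * (B.submatrix Fin.succ q.succAbove).det)] at key
  simpa [hB₀, hB₁, hM₀, hMsub, hsub] using key.symm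

theorem sum_range_pow_mul_ite_lt {R : Type*} [CommRing R] (t : R) (n q : ℕ) (hq : q ≤ n + 1) :
    ∑ j ∈ Finset.range (n + 1), t ^ j * (if j < q then t else 1) =
      ∑ j ∈ Finset.range n, t ^ (j + 1) + t ^ q := by
  induction n with
  | zero =>
    interval_cases q <;> simp
  | succ n ih =>
    rcases hq.eq_or_lt with rfl | hq
    · rw [← Finset.sum_range_succ]
      refine Finset.sum_congr rfl fun j hj => ?_
      rw [if_pos (Finset.mem_range.mp hj), pow_succ]
    · rw [Finset.sum_range_succ, ih (by omega), if_neg (by omega), Finset.sum_range_succ _ n]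
      ring

/-- A template matrix whose columns are each of type `(L, l)` (where `b = False`) or `(R, r)`
(where `b = True`), expanded in maximal minors of the matrix of values of `ystar` and `y`. -/
theorem det_TM_ite {A : Type*} [CommRing A] (s : Aˣ) (a : A)
    (y ystar l r L R : ℤ → A)
    (hyl : ∀ n : ℤ, y n = (↑s⁻¹ : A) * a * y (n - 1) + l n)
    (hyr : ∀ n : ℤ, y n = (↑s : A) * a * y (n - 1) + r n)
    (hyL : ∀ n : ℤ, ystar (n - 1) = (↑s⁻¹ : A) * a * ystar n + L (n - 1))
    (hyR : ∀ n : ℤ, ystar (n - 1) = (↑s : A) * a * ystar n + R (n - 1))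
    (kstar k : ℕ) (w : Fin (kstar + k) → ℤ) (b : ℕ → Prop) [DecidablePred b] :
    (TM kstar k w (fun j => if b j then (R, r) else (L, l))).det =
      ∑ q : Fin (kstar + k + 1), (-1) ^ (q : ℕ) *
        (∏ j ∈ Finset.range q, (↑s⁻¹ : A) * a * (if b j then (↑s : A) ^ 2 else 1)) *
        (Matrix.of fun (i : Fin (kstar + k)) (j : Fin (kstar + k)) =>
          if (i : ℕ) < kstar then ystar (w i - ((q.succAbove j : ℕ) : ℤ) + 1)
          else y (w i + ((q.succAbove j : ℕ) : ℤ) - 1)).det := by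
  have hs : (↑s⁻¹ : A) * a * (↑s : A) ^ 2 = ↑s * a := by
    linear_combination (↑s * a) * s.inv_mul
  refine Eq.trans (congrArg Matrix.det ?_) (Matrix.det_sub_mul_pred
    (Matrix.of fun (i : Fin (kstar + k)) (j : Fin (kstar + k + 1)) =>
      if (i : ℕ) < kstar then ystar (w i - ((j : ℕ) : ℤ) + 1)
      else y (w i + ((j : ℕ) : ℤ) - 1))
    (fun j => (↑s⁻¹ : A) * a * (if b j then (↑s : A) ^ 2 else 1)))
  ext i j
  have e₁ : w i - (((j : ℕ) : ℤ) + 1) + 1 = w i - ((j : ℕ) : ℤ) := by ring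
  have e₂ : w i + (((j : ℕ) : ℤ) + 1) - 1 = w i + ((j : ℕ) : ℤ) := by ring
  simp only [TM, Matrix.of_apply, Fin.val_succ, Fin.val_castSucc, Nat.cast_add, Nat.cast_one,
    e₁, e₂]
  have h₁ := hyL (w i - ((j : ℕ) : ℤ) + 1)
  have h₂ := hyR (w i - ((j : ℕ) : ℤ) + 1)
  rw [add_sub_cancel_right] at h₁ h₂
  have h₃ := hyl (w i + ((j : ℕ) : ℤ))
  have h₄ := hyr (w i + ((j : ℕ) : ℤ))
  split_ifs
  · rw [hs]; linear_combination -h₂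
  · linear_combination -h₁
  · rw [hs]; linear_combination -h₄
  · linear_combination -h₃

theorem stmt6 {A : Type*} [CommRing A] (s : Aˣ) (a : A)
    (y ystar l r L R : ℤ → A)
    (hyl : ∀ n : ℤ, y n = (↑s⁻¹ : A) * a * y (n - 1) + l n)
    (hyr : ∀ n : ℤ, y n = (↑s : A) * a * y (n - 1) + r n)
    (hyL : ∀ n : ℤ, ystar (n - 1) = (↑s⁻¹ : A) * a * ystar n + L (n - 1))
    (hyR : ∀ n : ℤ, ystar (n - 1) = (↑s : A) * a * ystar n + R (n - 1))
    (kstar k : ℕ) (hm : 1 ≤ kstar + k) (w : Fin (kstar + k) → ℤ) :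
    (∑ j ∈ Finset.Icc 1 (kstar + k - 1), ((↑s : A)) ^ (2 * j)) *
          (TM kstar k w (fun _ => (L, l))).det +
        (TM kstar k w (fun _ => (R, r))).det =
      ∑ j ∈ Finset.Icc 1 (kstar + k), ((↑s : A)) ^ (2 * j - 2) *
        (TM kstar k w (fun j' => if (j' : ℕ) = j - 1 then (R, r) else (L, l))).det := by
  have H := fun (b : ℕ → Prop) [DecidablePred b] =>
    det_TM_ite s a y ystar l r L R hyl hyr hyL hyR kstar k w b
  have hL := H fun _ => False
  have hR := H fun _ => True
  simp only [if_true, if_false] at hL hR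
  rw [hL, hR, Finset.sum_congr rfl fun j _ => congrArg _ (H fun i => i = j - 1)]
  obtain ⟨n, hn⟩ : ∃ n, kstar + k = n + 1 := ⟨kstar + k - 1, by omega⟩
  simp only [Finset.mul_sum]
  rw [Finset.sum_comm, ← Finset.sum_add_distrib]
  refine Finset.sum_congr rfl fun q _ => ?_
  have hsum := sum_range_pow_mul_ite_lt ((↑s : A) ^ 2) n q (by omega)
  have hIcc : ∀ (f : ℕ → A) (N : ℕ),
      ∑ j ∈ Finset.Icc 1 N, f j = ∑ j ∈ Finset.range N, f (j + 1) := fun f N => by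
    rw [Finset.range_eq_Ico, Finset.sum_Ico_add' f 0 N 1]
    rfl
  simp only [Finset.prod_mul_distrib, Finset.prod_const, Finset.card_range, Finset.prod_ite_eq',
    Finset.mem_range, mul_one]
  rw [hIcc, hIcc, show kstar + k - 1 = n by omega,
    show Finset.range (kstar + k) = Finset.range (n + 1) by rw [hn]]
  generalize Matrix.det (n := Fin (kstar + k)) (R := A) _ = D
  simp only [Nat.add_sub_cancel, show ∀ j, 2 * (j + 1) - 2 = 2 * j by omega, pow_mul]
  have hfac : ∀ j ∈ Finset.range (n + 1), ((↑s : A) ^ 2) ^ j *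
      ((-1) ^ (q : ℕ) * ((↑s⁻¹ : A) ^ (q : ℕ) * a ^ (q : ℕ) *
        (if j < (q : ℕ) then (↑s : A) ^ 2 else 1)) * D) =
      ((-1) ^ (q : ℕ) * ((↑s⁻¹ : A) ^ (q : ℕ) * a ^ (q : ℕ)) * D) *
        (((↑s : A) ^ 2) ^ j * (if j < (q : ℕ) then (↑s : A) ^ 2 else 1)) := fun j _ => by ring
  rw [Finset.sum_congr rfl hfac, ← Finset.mul_sum, hsum]
  ring
end

section
/- Let λ = (λ_1 ≥ … ≥ λ_k > 0) and μ = (μ_1 ≥ … ≥ μ_{k*} > 0) be partitions, not both empty, and set m = k* + k. Define w_i = μ_{k*−i+1} + i − 1 for 1 ≤ i ≤ k* and w_i = λ_{i−k*} − i + 1 for k* < i ≤ m; define α_i = v^{-1}·s^{2w_i+1} for i ≤ k* and α_i = v·s^{1−2w_i} for i > k*; and define c_w = s^{−2k*}·(Σ_{i=1}^{m} α_i + Σ_{j=1}^{m} β_j − δ·Σ_{j=1}^{m−1} s^{2j}). Then c_w = s_{μ,λ}. -/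
section ContentSums

variable {K : Type*} [Field K]

/-- The powers `s ^ (2 * c)`, with `c` running over the contents of row `i` of a Young diagram,
telescope after multiplication by `s - s⁻¹`. -/
theorem sub_inv_mul_sum_zpow_content {s : K} (hs : s ≠ 0) (n i : ℕ) :
    (s - s⁻¹) * ∑ j ∈ Finset.Icc 1 n, s ^ (2 * ((j : ℤ) - (i : ℤ) - 1)) =
      s ^ (2 * ((n : ℤ) - i) - 1) - s ^ (-(2 * (i : ℤ)) - 1) := by
  induction n with
  | zero => simp
  | succ n ih =>
    rw [Finset.sum_Icc_succ_top (by omega), mul_add, ih]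
    have h₁ : s ^ (2 * (((n + 1 : ℕ) : ℤ) - i) - 1) = s * s ^ (2 * ((n : ℤ) - i)) := by
      rw [← zpow_one_add₀ hs]; congr 1; push_cast; ring
    have h₂ : s ^ (2 * ((n : ℤ) - i) - 1) = s⁻¹ * s ^ (2 * ((n : ℤ) - i)) := by
      rw [zpow_sub_one₀ hs, mul_comm]
    have h₃ : s ^ (2 * (((n + 1 : ℕ) : ℤ) - i - 1)) = s ^ (2 * ((n : ℤ) - i)) := by
      congr 1; push_cast; ring
    rw [h₁, h₂, h₃]
    ring

theorem sub_inv_mul_sum_zpow_neg_content {s : K} (hs : s ≠ 0) (n i : ℕ) :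
    (s - s⁻¹) * ∑ j ∈ Finset.Icc 1 n, s ^ (-(2 * ((j : ℤ) - (i : ℤ) - 1))) =
      s ^ (2 * i + 1) - s ^ (1 - 2 * ((n : ℤ) - i)) := by
  have h := sub_inv_mul_sum_zpow_content (inv_ne_zero hs) n i
  simp only [inv_zpow', inv_inv] at h
  have h₁ : -(-(2 * (i : ℤ)) - 1) = ((2 * i + 1 : ℕ) : ℤ) := by push_cast; ring
  rw [h₁, zpow_natCast, neg_sub] at h
  linear_combination -h

theorem sub_inv_mul_sum_pow_odd {s : K} (hs : s ≠ 0) (n : ℕ) :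
    (s - s⁻¹) * ∑ i ∈ Finset.range n, s ^ (2 * i + 1) = s ^ (2 * n) - 1 := by
  induction n with
  | zero => simp
  | succ n ih =>
    rw [Finset.sum_range_succ, mul_add, ih]
    field_simp
    ring

theorem sub_inv_mul_sum_zpow_neg_odd {s : K} (hs : s ≠ 0) (n : ℕ) :
    (s - s⁻¹) * ∑ i ∈ Finset.range n, s ^ (-(2 * (i : ℤ)) - 1) =
      1 - s ^ (-(2 * (n : ℤ))) := by
  have h := sub_inv_mul_sum_pow_odd (inv_ne_zero hs) n
  have h₁ : ∀ i : ℕ, s ^ (-(2 * (i : ℤ)) - 1) = s⁻¹ ^ (2 * i + 1) := fun i ↦ by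
    rw [← zpow_natCast, inv_zpow']; congr 1; push_cast; ring
  have h₂ : s ^ (-(2 * (n : ℤ))) = s⁻¹ ^ (2 * n) := by
    rw [← zpow_natCast, inv_zpow']; push_cast; rfl
  simp only [h₁, h₂]
  rw [inv_inv] at h
  linear_combination -h

theorem sum_sub_mul_sum_eq (v s : K) {m : ℕ} (hm : 1 ≤ m) :
    (∑ j ∈ Finset.Icc 1 m, (v⁻¹ * s ^ (2 * j - 2) - v * s ^ (2 * j)) / (s - s⁻¹)) -
        ((v⁻¹ - v) / (s - s⁻¹)) * ∑ j ∈ Finset.Icc 1 (m - 1), s ^ (2 * j) =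
      (v⁻¹ - v * s ^ (2 * m)) / (s - s⁻¹) := by
  obtain ⟨m, rfl⟩ := Nat.exists_eq_add_of_le' hm
  rw [Nat.add_sub_cancel]
  clear hm
  induction m with
  | zero => simp
  | succ m ih =>
    rw [Finset.sum_Icc_succ_top (by omega), Finset.sum_Icc_succ_top (by omega) fun j ↦ s ^ (2 * j),
      show 2 * (m + 1 + 1) - 2 = 2 * (m + 1) by omega]
    linear_combination ih

end ContentSums


theorem stmt11 {K : Type*} [Field K] (v s : K) (hv : v ≠ 0) (hs : s ≠ 0)
    (hs2 : s ^ 2 ≠ 1) (k kstar : ℕ) (hm : 1 ≤ kstar + k)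
    (lam : Fin k → ℕ) (hlam : ∀ i j : Fin k, i ≤ j → lam j ≤ lam i)
    (hlampos : ∀ i, 0 < lam i)
    (mu : Fin kstar → ℕ) (hmu : ∀ i j : Fin kstar, i ≤ j → mu j ≤ mu i)
    (hmupos : ∀ i, 0 < mu i) :
    -- c_w = s^{-2k*}·(Σ α_i + Σ β_j − δ·Σ_{j=1}^{m-1} s^{2j}), where for 1-based i,
    -- w_i = μ_{k*-i+1} + i - 1 (i ≤ k*), w_i = λ_{i-k*} - i + 1 (i > k*),
    -- α_i = v⁻¹ s^{2w_i+1} (i ≤ k*), α_i = v s^{1-2w_i} (i > k*)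
    s ^ (-(2 * (kstar : ℤ))) *
        ((∑ i : Fin (kstar + k),
            if h : (i : ℕ) < kstar then
              v⁻¹ * s ^ (2 * (((mu ⟨kstar - 1 - (i : ℕ), by omega⟩ : ℕ) : ℤ) +
                ((i : ℕ) : ℤ)) + 1)
            else
              v * s ^ (1 - 2 * (((lam ⟨(i : ℕ) - kstar, by
                  have := i.isLt; omega⟩ : ℕ) : ℤ) - ((i : ℕ) : ℤ)))) +
          (∑ j ∈ Finset.Icc 1 (kstar + k),
            (v⁻¹ * s ^ (2 * j - 2) - v * s ^ (2 * j)) / (s - s⁻¹)) -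
          ((v⁻¹ - v) / (s - s⁻¹)) * ∑ j ∈ Finset.Icc 1 (kstar + k - 1), s ^ (2 * j)) =
      -- s_{μ,λ} via contents
      (s - s⁻¹) *
          (v⁻¹ * (∑ i : Fin kstar, ∑ j ∈ Finset.Icc 1 (mu i),
              s ^ (2 * ((j : ℤ) - ((i : ℕ) : ℤ) - 1))) -
            v * (∑ i : Fin k, ∑ j ∈ Finset.Icc 1 (lam i),
              s ^ (-(2 * ((j : ℤ) - ((i : ℕ) : ℤ) - 1))))) +
        (v⁻¹ - v) / (s - s⁻¹) := by
  have hd : s - s⁻¹ ≠ 0 := fun h ↦ hs2 <| by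
    rw [sq, ← mul_inv_cancel₀ hs, ← sub_eq_zero.mp h]
  rw [add_sub_assoc, sum_sub_mul_sum_eq v s hm, Fin.sum_univ_add]
  simp only [Fin.val_castAdd, Fin.val_natAdd, Fin.is_lt, dif_pos, dif_neg, not_lt,
    Nat.le_add_right, Nat.add_sub_cancel_left, Fin.eta]
  have hα : s ^ (-(2 * (kstar : ℤ))) * ∑ i : Fin kstar,
      v⁻¹ * s ^ (2 * ((mu ⟨kstar - 1 - i, by omega⟩ : ℤ) + (i : ℕ)) + 1) =
      v⁻¹ * ∑ i : Fin kstar, s ^ (2 * ((mu i : ℤ) - (i : ℕ)) - 1) := by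
    rw [← Equiv.sum_comp Fin.revPerm (fun i : Fin kstar ↦ s ^ (2 * ((mu i : ℤ) - (i : ℕ)) - 1)),
      Finset.mul_sum, Finset.mul_sum]
    refine Finset.sum_congr rfl fun i _ ↦ ?_
    have hi : (⟨kstar - 1 - i, by omega⟩ : Fin kstar) = Fin.rev i := by
      ext; simp only [Fin.val_rev]; omega
    rw [hi, mul_left_comm, ← zpow_add₀ hs, Fin.revPerm_apply]
    congr 2
    rw [Fin.val_rev, Nat.cast_sub (by omega)]
    push_cast
    ring
  have hα' : s ^ (-(2 * (kstar : ℤ))) * ∑ i : Fin k,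
      v * s ^ (1 - 2 * ((lam i : ℤ) - ((kstar + i : ℕ) : ℤ))) =
      v * ∑ i : Fin k, s ^ (1 - 2 * ((lam i : ℤ) - (i : ℕ))) := by
    rw [Finset.mul_sum, Finset.mul_sum]
    refine Finset.sum_congr rfl fun i _ ↦ ?_
    rw [mul_left_comm, ← zpow_add₀ hs]
    congr 2
    push_cast
    ring
  have hμ : (s - s⁻¹) * ∑ i : Fin kstar, ∑ j ∈ Finset.Icc 1 (mu i),
      s ^ (2 * ((j : ℤ) - ((i : ℕ) : ℤ) - 1)) =
      ∑ i : Fin kstar, s ^ (2 * ((mu i : ℤ) - (i : ℕ)) - 1) -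
        (1 - s ^ (-(2 * (kstar : ℤ)))) / (s - s⁻¹) := by
    rw [← sub_inv_mul_sum_zpow_neg_odd hs, mul_div_cancel_left₀ _ hd, Finset.sum_range,
      ← Finset.sum_sub_distrib, Finset.mul_sum]
    exact Finset.sum_congr rfl fun i _ ↦ sub_inv_mul_sum_zpow_content hs _ _
  have hlam' : (s - s⁻¹) * ∑ i : Fin k, ∑ j ∈ Finset.Icc 1 (lam i),
      s ^ (-(2 * ((j : ℤ) - ((i : ℕ) : ℤ) - 1))) =
      (s ^ (2 * k) - 1) / (s - s⁻¹) -
        ∑ i : Fin k, s ^ (1 - 2 * ((lam i : ℤ) - (i : ℕ))) := by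
    rw [← sub_inv_mul_sum_pow_odd hs, mul_div_cancel_left₀ _ hd, Finset.sum_range,
      ← Finset.sum_sub_distrib, Finset.mul_sum]
    exact Finset.sum_congr rfl fun i _ ↦ sub_inv_mul_sum_zpow_neg_content hs _ _
  have hpow : s ^ (-(2 * (kstar : ℤ))) * s ^ (2 * (kstar + k)) = s ^ (2 * k) := by
    rw [← zpow_natCast, ← zpow_natCast, ← zpow_add₀ hs]
    congr 1
    push_cast
    ring
  linear_combination hα + hα' - v⁻¹ * hμ + v * hlam' - v / (s - s⁻¹) * hpow
end

section
/- For all integers n with 0 ≤ n ≤ N, F_n = F_{N−n}. -/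
theorem prod_Icc_div_reflect_eq {K : Type*} [Field K] (g : ℕ → K) (N : ℕ)
    (hg : ∀ i, 1 ≤ i → i ≤ N → g i ≠ 0) (n : ℕ) (hn : n ≤ N) :
    ∏ i ∈ Finset.Icc 1 n, g (N + 1 - i) / g i =
      (∏ i ∈ Finset.Icc 1 N, g i) /
        ((∏ i ∈ Finset.Icc 1 n, g i) * ∏ i ∈ Finset.Icc 1 (N - n), g i) := by
  have hP : ∀ m ≤ N, ∏ i ∈ Finset.Icc 1 m, g i ≠ 0 := fun m hm =>
    Finset.prod_ne_zero_iff.mpr fun i hi =>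
      hg i (Finset.mem_Icc.mp hi).1 ((Finset.mem_Icc.mp hi).2.trans hm)
  induction n with
  | zero => simp [div_self (hP N le_rfl)]
  | succ n ih =>
    obtain ⟨m, rfl⟩ := Nat.exists_eq_add_of_le hn
    have h₁ : n + 1 + m - n = m + 1 := by omega
    have h₂ : n + 1 + m - (n + 1) = m := by omega
    have h₃ : n + 1 + m + 1 - (n + 1) = m + 1 := by omega
    rw [Finset.prod_Icc_succ_top (by omega), ih (by omega), h₁, h₂, h₃,
      Finset.prod_Icc_succ_top (b := m) (by omega),
      Finset.prod_Icc_succ_top (b := n) (by omega)]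
    have := hP n (by omega)
    have := hP m (by omega)
    have := hg (n + 1) (by omega) (by omega)
    have := hg (m + 1) (by omega) (by omega)
    field_simp

theorem zpow_sub_zpow_neg_ne_zero {K : Type*} [Field K] {s : K} (hs : s ≠ 0) {i : ℕ}
    (hi : s ^ (2 * i) ≠ 1) : s ^ (i : ℤ) - s ^ (-(i : ℤ)) ≠ 0 := by
  intro h
  apply hi
  rw [zpow_neg, zpow_natCast, sub_eq_zero] at h
  rw [two_mul, pow_add]
  nth_rewrite 1 [h]
  exact inv_mul_cancel₀ (pow_ne_zero i hs)

theorem neg_one_pow_mul_prod_eq_prod_reflect {K : Type*} [Field K] {s : K} (hs : s ≠ 0)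
    {N n : ℕ} (hn : n ≤ N) :
    (-1 : K) ^ n * ∏ i ∈ Finset.Icc 1 n,
        (-s ^ N * s ^ (-(i : ℤ) + 1) - (-s ^ N)⁻¹ * s ^ ((i : ℤ) - 1)) /
          (s ^ (i : ℤ) - s ^ (-(i : ℤ))) =
      ∏ i ∈ Finset.Icc 1 n,
        (s ^ ((N + 1 - i : ℕ) : ℤ) - s ^ (-((N + 1 - i : ℕ) : ℤ))) /
          (s ^ (i : ℤ) - s ^ (-(i : ℤ))) := by
  have hcard : (-1 : K) ^ n = ∏ _i ∈ Finset.Icc 1 n, (-1 : K) := by simp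
  rw [hcard, ← Finset.prod_mul_distrib]
  refine Finset.prod_congr rfl fun i hi => ?_
  have hi' := Finset.mem_Icc.mp hi
  have h₁ : s ^ ((N + 1 - i : ℕ) : ℤ) = s ^ N * s ^ (-(i : ℤ) + 1) := by
    rw [← zpow_natCast s N, ← zpow_add₀ hs]
    congr 1
    omega
  have h₂ : s ^ (-((N + 1 - i : ℕ) : ℤ)) = (s ^ N)⁻¹ * s ^ ((i : ℤ) - 1) := by
    rw [← zpow_natCast s N, ← zpow_neg, ← zpow_add₀ hs]
    congr 1
    omega
  rw [h₁, h₂, inv_neg]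
  ring

theorem stmt12 {K : Type*} [Field K] (N : ℕ) (hN : 1 ≤ N) (s : K) (hs : s ≠ 0)
    (hsroots : ∀ i : ℕ, 1 ≤ i → i ≤ N → s ^ (2 * i) ≠ 1)
    (v : K) (hv : v = -s ^ N) (n : ℕ) (hn : n ≤ N) :
    (-1 : K) ^ n * ∏ i ∈ Finset.Icc 1 n,
        (v * s ^ (-(i : ℤ) + 1) - v⁻¹ * s ^ ((i : ℤ) - 1)) /
          (s ^ (i : ℤ) - s ^ (-(i : ℤ))) =
      (-1 : K) ^ (N - n) * ∏ i ∈ Finset.Icc 1 (N - n),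
        (v * s ^ (-(i : ℤ) + 1) - v⁻¹ * s ^ ((i : ℤ) - 1)) /
          (s ^ (i : ℤ) - s ^ (-(i : ℤ))) := by
  subst hv
  have key := prod_Icc_div_reflect_eq (fun i : ℕ => s ^ (i : ℤ) - s ^ (-(i : ℤ))) N
    fun i h₁ h₂ => zpow_sub_zpow_neg_ne_zero hs (hsroots i h₁ h₂)
  rw [neg_one_pow_mul_prod_eq_prod_reflect hs hn,
    neg_one_pow_mul_prod_eq_prod_reflect hs (Nat.sub_le N n), key n hn,
    key (N - n) (Nat.sub_le N n), Nat.sub_sub_self hn, mul_comm (∏ i ∈ Finset.Icc 1 n, _)]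
end
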